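/- Suppose A ∈ ℝ^{n×n} is symmetric with nonnegative entries, has minimum node degree at least α ≥ 0, and satisfies ‖A‖₂ ≤ β_A; suppose ‖X‖_F ≤ β_X and σ is ρ-Lipschitz with σ(0) = 0. Let W^{(1)},…,W^{(L)} and W′^{(1)},…,W′^{(L)} be two sets of GCN weight matrices with ‖W^{(l)}‖₂ ≤ β̂_W, ‖W′^{(l)}‖₂ ≤ β̂_W and ‖W^{(l)} − W′^{(l)}‖₂ ≤ β̂_{ΔW} for all l, and let z = (1/n) 1ᵀ X^{(L)} and z′ = (1/n) 1ᵀ X′^{(L)} be the corresponding average-pooled representations. Then ‖z − z′‖ ≤ (L/√n) ρ^L (1 + α)^{−L} (1 + β_A)^L β̂_W^{L−1} β̂_{ΔW} β_X. -/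

import Mathlib

open Matrix BigOperators Finset

noncomputable def specNorm {m n : Type*} [Fintype m] [Fintype n] [DecidableEq n]
    (A : Matrix m n ℝ) : ℝ :=
  ‖LinearMap.toContinuousLinearMap (Matrix.toEuclideanLin A)‖

noncomputable def frobNorm {m n : Type*} [Fintype m] [Fintype n] (A : Matrix m n ℝ) : ℝ :=
  Real.sqrt (∑ i, ∑ j, (A i j) ^ 2)

noncomputable def vecNorm {ι : Type*} [Fintype ι] (v : ι → ℝ) : ℝ :=
  Real.sqrt (∑ i, (v i) ^ 2)

noncomputable def normAdj {v : Type*} [Fintype v] [DecidableEq v]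
    (A : Matrix v v ℝ) : Matrix v v ℝ :=
  Matrix.diagonal (fun i => (Real.sqrt (∑ j, (1 + A) i j))⁻¹) * (1 + A) *
    Matrix.diagonal (fun i => (Real.sqrt (∑ j, (1 + A) i j))⁻¹)

noncomputable def deltaD {v : Type*} [Fintype v] [DecidableEq v]
    (A ΔA : Matrix v v ℝ) : Matrix v v ℝ :=
  1 - Matrix.diagonal (fun i => Real.sqrt (∑ j, (1 + (A + ΔA)) i j)) *
      Matrix.diagonal (fun i => (Real.sqrt (∑ j, (1 + A) i j))⁻¹)

noncomputable def gcn {v : Type*} [Fintype v] (U : Matrix v v ℝ) (σ : ℝ → ℝ)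
    {d : ℕ → ℕ} (W : (l : ℕ) → Matrix (Fin (d l)) (Fin (d (l + 1))) ℝ)
    (X0 : Matrix v (Fin (d 0)) ℝ) : (l : ℕ) → Matrix v (Fin (d l)) ℝ
  | 0 => X0
  | l + 1 => (U * gcn U σ W X0 l * W l).map σ

noncomputable def avgPool {v p : Type*} [Fintype v] [Fintype p]
    (X : Matrix v p ℝ) : p → ℝ :=
  fun j => (∑ i, X i j) / (Fintype.card v : ℝ)

noncomputable def ensembleRep {n M : ℕ} {d : ℕ → ℕ} (A : Matrix (Fin n) (Fin n) ℝ)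
    (σ : ℝ → ℝ) (W : Fin M → (l : ℕ) → Matrix (Fin (d l)) (Fin (d (l + 1))) ℝ)
    (X : Matrix (Fin n) (Fin (d 0)) ℝ) (lam : Fin M → ℝ) (L : ℕ) : Fin (d L) → ℝ :=
  fun j => ∑ m, lam m * avgPool (gcn (normAdj A) σ (W m) X L) j

def principalSub {n : ℕ} (A : Matrix (Fin n) (Fin n) ℝ) (s : Finset (Fin n)) :
    Matrix s s ℝ :=
  A.submatrix (fun i => (i : Fin n)) (fun j => (j : Fin n))

def rowSub {n p : ℕ} (X : Matrix (Fin n) (Fin p) ℝ) (s : Finset (Fin n)) :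
    Matrix s (Fin p) ℝ :=
  X.submatrix (fun i => (i : Fin n)) id

open scoped Matrix.Norms.L2Operator in
theorem specNorm_eq_l2_opNorm {m n : Type*} [Fintype m] [Fintype n] [DecidableEq n]
    (M : Matrix m n ℝ) : specNorm M = ‖M‖ :=
  rfl

theorem specNorm_nonneg {m n : Type*} [Fintype m] [Fintype n] [DecidableEq n]
    (M : Matrix m n ℝ) : 0 ≤ specNorm M :=
  norm_nonneg _

open scoped Matrix.Norms.L2Operator in
theorem specNorm_add_le {m n : Type*} [Fintype m] [Fintype n] [DecidableEq n]
    (M N : Matrix m n ℝ) : specNorm (M + N) ≤ specNorm M + specNorm N := by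
  simpa only [specNorm_eq_l2_opNorm] using norm_add_le M N

theorem specNorm_mul_le {m n p : Type*} [Fintype m] [Fintype n] [Fintype p] [DecidableEq n]
    [DecidableEq p] (M : Matrix m n ℝ) (N : Matrix n p ℝ) :
    specNorm (M * N) ≤ specNorm M * specNorm N := by
  simpa only [specNorm_eq_l2_opNorm] using Matrix.l2_opNorm_mul M N

theorem specNorm_transpose {m n : Type*} [Fintype m] [Fintype n] [DecidableEq m] [DecidableEq n]
    (M : Matrix m n ℝ) : specNorm Mᵀ = specNorm M := by
  simpa only [specNorm_eq_l2_opNorm, conjTranspose_eq_transpose_of_trivial] using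
    Matrix.l2_opNorm_conjTranspose M

theorem specNorm_diagonal_le {n : Type*} [Fintype n] [DecidableEq n] {v : n → ℝ} {c : ℝ}
    (hc : 0 ≤ c) (hv : ∀ i, |v i| ≤ c) : specNorm (diagonal v) ≤ c := by
  rw [specNorm_eq_l2_opNorm, Matrix.l2_opNorm_diagonal]
  exact (pi_norm_le_iff_of_nonneg hc).2 hv

theorem specNorm_one_le {n : Type*} [Fintype n] [DecidableEq n] :
    specNorm (1 : Matrix n n ℝ) ≤ 1 := by
  rw [← diagonal_one]
  exact specNorm_diagonal_le zero_le_one (by simp)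

theorem frobNorm_nonneg {m n : Type*} [Fintype m] [Fintype n] (M : Matrix m n ℝ) :
    0 ≤ frobNorm M :=
  Real.sqrt_nonneg _

theorem sq_frobNorm {m n : Type*} [Fintype m] [Fintype n] (M : Matrix m n ℝ) :
    frobNorm M ^ 2 = ∑ i, ∑ j, M i j ^ 2 :=
  Real.sq_sqrt (by positivity)

open scoped Matrix.Norms.Frobenius in
theorem frobNorm_eq_norm {m n : Type*} [Fintype m] [Fintype n] (M : Matrix m n ℝ) :
    frobNorm M = ‖M‖ := by
  simp [frobNorm, Matrix.frobenius_norm_def, Real.sqrt_eq_rpow]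

open scoped Matrix.Norms.Frobenius in
theorem frobNorm_add_le {m n : Type*} [Fintype m] [Fintype n] (M N : Matrix m n ℝ) :
    frobNorm (M + N) ≤ frobNorm M + frobNorm N := by
  simpa only [frobNorm_eq_norm] using norm_add_le M N

theorem frobNorm_transpose {m n : Type*} [Fintype m] [Fintype n] (M : Matrix m n ℝ) :
    frobNorm Mᵀ = frobNorm M := by
  simp only [frobNorm, transpose_apply]
  rw [Finset.sum_comm]

theorem sum_sq_mulVec_le {m n : Type*} [Fintype m] [Fintype n] [DecidableEq n]
    (M : Matrix m n ℝ) (x : n → ℝ) :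
    ∑ i, (M *ᵥ x) i ^ 2 ≤ specNorm M ^ 2 * ∑ j, x j ^ 2 := by
  have h := (LinearMap.toContinuousLinearMap (Matrix.toEuclideanLin M)).le_opNorm
    (WithLp.toLp 2 x)
  have h2 := pow_le_pow_left₀ (norm_nonneg _) h 2
  simpa [mul_pow, EuclideanSpace.norm_sq_eq, specNorm, Matrix.toLpLin_toLp] using h2

theorem frobNorm_mul_le_specNorm_mul {m n p : Type*} [Fintype m] [Fintype n] [Fintype p]
    [DecidableEq n] (M : Matrix m n ℝ) (N : Matrix n p ℝ) :
    frobNorm (M * N) ≤ specNorm M * frobNorm N := by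
  refine (sq_le_sq₀ (frobNorm_nonneg _) (mul_nonneg (specNorm_nonneg M) (frobNorm_nonneg N))).1 ?_
  rw [mul_pow, sq_frobNorm, sq_frobNorm, Finset.sum_comm, Finset.sum_comm (s := univ (α := n)),
    Finset.mul_sum]
  exact Finset.sum_le_sum fun j _ => sum_sq_mulVec_le M fun k => N k j

theorem frobNorm_mul_le_mul_specNorm {m n p : Type*} [Fintype m] [Fintype n] [Fintype p]
    [DecidableEq n] [DecidableEq p] (M : Matrix m n ℝ) (N : Matrix n p ℝ) :
    frobNorm (M * N) ≤ frobNorm M * specNorm N := by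
  rw [← frobNorm_transpose, transpose_mul, ← frobNorm_transpose M, ← specNorm_transpose N,
    mul_comm]
  exact frobNorm_mul_le_specNorm_mul _ _

theorem frobNorm_map_sub_map_le {m n : Type*} [Fintype m] [Fintype n] {σ : ℝ → ℝ} {ρ : ℝ}
    (hρ : 0 ≤ ρ) (hσ : ∀ a b, |σ a - σ b| ≤ ρ * |a - b|) (M N : Matrix m n ℝ) :
    frobNorm (M.map σ - N.map σ) ≤ ρ * frobNorm (M - N) := by
  refine (sq_le_sq₀ (frobNorm_nonneg _) (mul_nonneg hρ (frobNorm_nonneg _))).1 ?_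
  rw [mul_pow, sq_frobNorm, sq_frobNorm, Finset.mul_sum]
  refine Finset.sum_le_sum fun i _ => ?_
  rw [Finset.mul_sum]
  refine Finset.sum_le_sum fun j _ => ?_
  have h := pow_le_pow_left₀ (abs_nonneg _) (hσ (M i j) (N i j)) 2
  simpa [mul_pow] using h

theorem frobNorm_map_le {m n : Type*} [Fintype m] [Fintype n] {σ : ℝ → ℝ} {ρ : ℝ}
    (hρ : 0 ≤ ρ) (hσ : ∀ a b, |σ a - σ b| ≤ ρ * |a - b|) (hσ0 : σ 0 = 0) (M : Matrix m n ℝ) :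
    frobNorm (M.map σ) ≤ ρ * frobNorm M := by
  simpa [Matrix.map_zero _ hσ0] using frobNorm_map_sub_map_le hρ hσ M 0

theorem vecNorm_avgPool_le {v p : Type*} [Fintype v] [Fintype p] [Nonempty v]
    (M : Matrix v p ℝ) :
    vecNorm (avgPool M) ≤ frobNorm M / Real.sqrt (Fintype.card v) := by
  have hc : (0 : ℝ) < Fintype.card v := by exact_mod_cast Fintype.card_pos
  rw [vecNorm, frobNorm, ← Real.sqrt_div (by positivity)]
  refine Real.sqrt_le_sqrt ?_
  rw [Finset.sum_comm, Finset.sum_div]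
  refine Finset.sum_le_sum fun j _ => ?_
  rw [avgPool, div_pow, div_le_div_iff₀ (by positivity) hc]
  have h : (∑ i, M i j) ^ 2 ≤ Fintype.card v * ∑ i, M i j ^ 2 :=
    sq_sum_le_card_mul_sum_sq
  nlinarith

theorem avgPool_sub {v p : Type*} [Fintype v] [Fintype p] (M N : Matrix v p ℝ) :
    avgPool (M - N) = avgPool M - avgPool N := by
  ext j
  simp [avgPool, sub_div]

theorem specNorm_normAdj_le {v : Type*} [Fintype v] [DecidableEq v] {A : Matrix v v ℝ} {α : ℝ}
    (hα : 0 ≤ α) (hdeg : ∀ i, α ≤ ∑ j, A i j) :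
    specNorm (normAdj A) ≤ (1 + specNorm A) / (1 + α) := by
  have hs : 0 < Real.sqrt (1 + α) := Real.sqrt_pos.2 (by linarith)
  have hdiag : specNorm (diagonal fun i => (Real.sqrt (∑ j, (1 + A) i j))⁻¹) ≤
      (Real.sqrt (1 + α))⁻¹ := by
    refine specNorm_diagonal_le (inv_nonneg.2 hs.le) fun i => ?_
    rw [abs_of_nonneg (by positivity)]
    refine inv_anti₀ hs (Real.sqrt_le_sqrt ?_)
    simpa [Finset.sum_add_distrib, Matrix.one_apply] using hdeg i
  have hone : specNorm (1 + A) ≤ 1 + specNorm A :=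
    (specNorm_add_le _ _).trans (by gcongr; exact specNorm_one_le)
  have hA := specNorm_nonneg A
  calc specNorm (normAdj A)
      ≤ (Real.sqrt (1 + α))⁻¹ * (1 + specNorm A) * (Real.sqrt (1 + α))⁻¹ := by
        refine (specNorm_mul_le _ _).trans ?_
        refine mul_le_mul ((specNorm_mul_le _ _).trans ?_) hdiag (specNorm_nonneg _)
          (by positivity)
        exact mul_le_mul hdiag hone (specNorm_nonneg _) (by positivity)
    _ = (1 + specNorm A) / (Real.sqrt (1 + α) * Real.sqrt (1 + α)) := by
        field_simp
    _ = (1 + specNorm A) / (1 + α) := by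
        rw [Real.mul_self_sqrt (by linarith)]

theorem frobNorm_mul_mul_le {m n p q : Type*} [Fintype m] [Fintype n] [Fintype p] [Fintype q]
    [DecidableEq n] [DecidableEq p] [DecidableEq q] {U : Matrix m n ℝ} {H : Matrix n p ℝ}
    {W : Matrix p q ℝ} {u h w : ℝ} (hU : specNorm U ≤ u) (hH : frobNorm H ≤ h)
    (hW : specNorm W ≤ w) : frobNorm (U * H * W) ≤ u * h * w := by
  have hu := (specNorm_nonneg U).trans hU
  have hh := (frobNorm_nonneg H).trans hH
  refine (frobNorm_mul_le_mul_specNorm _ _).trans ?_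
  refine mul_le_mul ((frobNorm_mul_le_specNorm_mul _ _).trans ?_) hW (specNorm_nonneg _)
    (by positivity)
  exact mul_le_mul hU hH (frobNorm_nonneg _) hu

theorem frobNorm_gcn_le {v : Type*} [Fintype v] [DecidableEq v] {d : ℕ → ℕ}
    {U : Matrix v v ℝ} {σ : ℝ → ℝ} {W : (l : ℕ) → Matrix (Fin (d l)) (Fin (d (l + 1))) ℝ}
    {X : Matrix v (Fin (d 0)) ℝ} {u ρ w x : ℝ} (hU : specNorm U ≤ u) (hX : frobNorm X ≤ x)
    (hρ : 0 ≤ ρ) (hσ : ∀ a b, |σ a - σ b| ≤ ρ * |a - b|) (hσ0 : σ 0 = 0) (l : ℕ)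
    (hW : ∀ k < l, specNorm (W k) ≤ w) :
    frobNorm (gcn U σ W X l) ≤ (ρ * u * w) ^ l * x := by
  induction l with
  | zero => simpa [gcn] using hX
  | succ l ih =>
    have h := frobNorm_mul_mul_le hU (ih fun k hk => hW k (by omega)) (hW l (by omega))
    calc frobNorm (gcn U σ W X (l + 1))
        ≤ ρ * frobNorm (U * gcn U σ W X l * W l) := frobNorm_map_le hρ hσ hσ0 _
      _ ≤ ρ * (u * ((ρ * u * w) ^ l * x) * w) := by gcongr
      _ = (ρ * u * w) ^ (l + 1) * x := by ring

theorem frobNorm_gcn_sub_gcn_le {v : Type*} [Fintype v] [DecidableEq v] {d : ℕ → ℕ}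
    {U : Matrix v v ℝ} {σ : ℝ → ℝ} {W W' : (l : ℕ) → Matrix (Fin (d l)) (Fin (d (l + 1))) ℝ}
    {X : Matrix v (Fin (d 0)) ℝ} {u ρ w δ x : ℝ} (hU : specNorm U ≤ u) (hX : frobNorm X ≤ x)
    (hρ : 0 ≤ ρ) (hσ : ∀ a b, |σ a - σ b| ≤ ρ * |a - b|) (hσ0 : σ 0 = 0) (l : ℕ)
    (hW : ∀ k < l, specNorm (W k) ≤ w) (hW' : ∀ k < l, specNorm (W' k) ≤ w)
    (hδ : ∀ k < l, specNorm (W k - W' k) ≤ δ) :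
    frobNorm (gcn U σ W X l - gcn U σ W' X l) ≤
      l * (ρ * u) ^ l * w ^ (l - 1) * δ * x := by
  induction l with
  | zero => simp [gcn, frobNorm]
  | succ l ih =>
    have hdiff := frobNorm_mul_mul_le hU (ih (fun k hk => hW k (by omega))
      (fun k hk => hW' k (by omega)) fun k hk => hδ k (by omega)) (hW l (by omega))
    have hgcn := frobNorm_mul_mul_le hU
      (frobNorm_gcn_le hU hX hρ hσ hσ0 l fun k hk => hW' k (by omega)) (hδ l (by omega))
    have hsplit : U * gcn U σ W X l * W l - U * gcn U σ W' X l * W' l =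
        U * (gcn U σ W X l - gcn U σ W' X l) * W l +
          U * gcn U σ W' X l * (W l - W' l) := by
      rw [Matrix.mul_sub, Matrix.sub_mul, Matrix.mul_sub]
      abel
    calc frobNorm (gcn U σ W X (l + 1) - gcn U σ W' X (l + 1))
        ≤ ρ * frobNorm (U * gcn U σ W X l * W l - U * gcn U σ W' X l * W' l) :=
          frobNorm_map_sub_map_le hρ hσ _ _
      _ ≤ ρ * (u * (l * (ρ * u) ^ l * w ^ (l - 1) * δ * x) * w +
            u * ((ρ * u * w) ^ l * x) * δ) := by
          rw [hsplit]
          gcongr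
          exact (frobNorm_add_le _ _).trans (add_le_add hdiff hgcn)
      _ = (l + 1 : ℕ) * (ρ * u) ^ (l + 1) * w ^ (l + 1 - 1) * δ * x := by
          cases l with
          | zero => simp; ring
          | succ l => push_cast [Nat.add_sub_cancel]; ring

theorem pooled_rep_weight_perturb_le {n : ℕ} {d : ℕ → ℕ} (hn : 0 < n)
    (A : Matrix (Fin n) (Fin n) ℝ) (X : Matrix (Fin n) (Fin (d 0)) ℝ)
    (W W' : (l : ℕ) → Matrix (Fin (d l)) (Fin (d (l + 1))) ℝ) (L : ℕ) (hL : 1 ≤ L)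
    (σ : ℝ → ℝ) (α βA βX βW βΔW ρ : ℝ)
    (hsymm : A.IsSymm) (hnonneg : ∀ i j, 0 ≤ A i j)
    (hα : 0 ≤ α) (hdeg : ∀ i, α ≤ ∑ j, A i j) (hA : specNorm A ≤ βA)
    (hX : frobNorm X ≤ βX)
    (hW : ∀ l < L, specNorm (W l) ≤ βW) (hW' : ∀ l < L, specNorm (W' l) ≤ βW)
    (hΔW : ∀ l < L, specNorm (W l - W' l) ≤ βΔW)
    (hρ : 0 ≤ ρ) (hσ : ∀ a b : ℝ, |σ a - σ b| ≤ ρ * |a - b|) (hσ0 : σ 0 = 0) :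
    vecNorm (avgPool (gcn (normAdj A) σ W X L) - avgPool (gcn (normAdj A) σ W' X L)) ≤
      ((L : ℝ) / Real.sqrt n) * ρ ^ L * ((1 + α) ^ L)⁻¹ * (1 + βA) ^ L *
        βW ^ (L - 1) * βΔW * βX := by
  have : Nonempty (Fin n) := ⟨⟨0, hn⟩⟩
  have hU : specNorm (normAdj A) ≤ (1 + βA) / (1 + α) :=
    (specNorm_normAdj_le hα hdeg).trans (by gcongr)
  rw [← avgPool_sub]
  calc _ ≤ _ := vecNorm_avgPool_le _
    _ ≤ (L * (ρ * ((1 + βA) / (1 + α))) ^ L * βW ^ (L - 1) * βΔW * βX) / Real.sqrt n := by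
      rw [Fintype.card_fin]
      gcongr
      exact frobNorm_gcn_sub_gcn_le hU hX hρ hσ hσ0 L hW hW' hΔW
    _ = _ := by
      rw [mul_pow, div_pow]
      ring
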